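/- Let h and p be polynomials over ℂ with p ≠ 0. Then p divides p'' + 2·p'·h' if and only if p has only simple zeros and every zero z_k of p satisfies Σ_{j ≠ k} 1/(z_k − z_j) = −h'(z_k), where the sum is over all other zeros z_j of p. -/

import Mathlib

open Polynomial

lemma hs_key (h p : Polynomial ℂ) (hp : p ≠ 0) (hn : p.roots.Nodup) (z : ℂ)
    (hz : z ∈ p.roots) :
    (derivative (derivative p) + 2 * derivative p * derivative h).IsRoot z ↔
      ∑ w ∈ p.roots.toFinset.erase z, (1 : ℂ) / (z - w) = -((derivative h).eval z) := by
  obtain ⟨q, rfl⟩ := dvd_iff_isRoot.mpr (isRoot_of_mem_roots hz)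
  have hq : q ≠ 0 := right_ne_zero_of_mul hp
  have hr : ((X - C z) * q).roots = z ::ₘ q.roots := by
    rw [roots_mul hp, roots_X_sub_C, Multiset.singleton_add]
  rw [hr] at hn ⊢
  obtain ⟨hzq, hnq⟩ := Multiset.nodup_cons.mp hn
  have hqz : q.eval z ≠ 0 := fun e => hzq ((mem_roots hq).mpr e)
  have hs := (IsAlgClosed.splits q).eval_derivative_div_eval_of_ne_zero hqz
  have he : (z ::ₘ q.roots).toFinset.erase z = q.roots.toFinset := by
    rw [Multiset.toFinset_cons, Finset.erase_insert (by simpa using hzq)]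
  have hsum : ∑ w ∈ q.roots.toFinset, (1 : ℂ) / (z - w)
      = (q.roots.map fun w => 1 / (z - w)).sum := by
    rw [Finset.sum, Multiset.toFinset_val, hnq.dedup]
  rw [he, hsum, ← hs, div_eq_iff hqz]
  simp only [IsRoot.def, derivative_mul, derivative_add, derivative_sub, derivative_X, derivative_C,
    eval_add, eval_mul, eval_sub, eval_X, eval_C, eval_one, eval_zero, eval_ofNat,
    derivative_one, sub_self, sub_zero]
  constructor
  · intro e
    linear_combination e / 2
  · intro e
    linear_combination 2 * e

lemma hs_nodup (h p : Polynomial ℂ) (hp : p ≠ 0)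
    (hd : p ∣ (derivative (derivative p) + 2 * derivative p * derivative h)) :
    p.roots.Nodup := by
  rw [Multiset.nodup_iff_count_le_one]
  intro z
  rw [count_roots]
  by_contra! hm
  have hroot : p.IsRoot z := (rootMultiplicity_pos hp).mp (by omega)
  have h1 := derivative_rootMultiplicity_of_root hroot
  have hp' : derivative p ≠ 0 := by
    intro e
    rw [e, rootMultiplicity_zero] at h1
    omega
  have hroot' : (derivative p).IsRoot z := (rootMultiplicity_pos hp').mp (by omega)
  have h2 := derivative_rootMultiplicity_of_root hroot'
  have hp'' : derivative (derivative p) ≠ 0 := by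
    intro e
    have hc := eq_C_of_natDegree_eq_zero (derivative_eq_zero.mp e)
    rw [hc] at hroot'
    simp at hroot'
    rw [hroot'] at hc
    exact hp' (hc.trans C_0)
  have d1 : (X - C z) ^ (p.rootMultiplicity z - 1) ∣ derivative p := by
    rw [← h1]; exact pow_rootMultiplicity_dvd _ _
  have d2 : (X - C z) ^ (p.rootMultiplicity z - 1) ∣
      derivative (derivative p) + 2 * derivative p * derivative h :=
    ((pow_dvd_pow _ (Nat.sub_le _ _)).trans (pow_rootMultiplicity_dvd p z)).trans hd
  have d3 := (dvd_add_left ((d1.mul_left 2).mul_right (derivative h))).mp d2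
  have := (le_rootMultiplicity_iff hp'').mpr d3
  omega

theorem heine_stieltjes_criterion (h p : Polynomial ℂ) (hp : p ≠ 0) :
    p ∣ (derivative (derivative p) + 2 * derivative p * derivative h) ↔
    (p.roots.Nodup ∧ ∀ z ∈ p.roots.toFinset,
      ∑ w ∈ p.roots.toFinset.erase z, (1 : ℂ) / (z - w) =
        -((derivative h).eval z)) := by
  constructor
  · intro hd
    have hn := hs_nodup h p hp hd
    refine ⟨hn, fun z hz => ?_⟩
    rw [Multiset.mem_toFinset] at hz
    exact (hs_key h p hp hn z hz).mp ((isRoot_of_mem_roots hz).dvd hd)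
  · rintro ⟨hn, H⟩
    by_cases hf : derivative (derivative p) + 2 * derivative p * derivative h = 0
    · rw [hf]; exact dvd_zero _
    · refine ((IsAlgClosed.splits p).dvd_iff_roots_le_roots hp hf).mpr ?_
      rw [Multiset.le_iff_subset hn]
      intro z hz
      exact (mem_roots hf).mpr ((hs_key h p hp hn z hz).mpr (H z (by simpa using hz)))
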